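/- Energy identity with nonlinear Robin boundary conditions. Let $f : [0,1]\times\mathbb{R}^4 \to \mathbb{R}$ be continuously differentiable, with arguments $f(x,u,p,q,r)$ and $f_q$ the partial derivative in the fourth argument, and define $F^1(x,u,p,q,r) := f(x,u,p,0,0) + f_q(x,u,p,0,0)\,q - f(x,u,p,q,r)$. Let $g : [0,1]\times\mathbb{R}^2 \to \mathbb{R}$ be continuous, and let $L : [0,1]\times\mathbb{R}^2 \to \mathbb{R}$ be twice continuously differentiable with $L_{pp}(x,u,p) = f_q(x,u,p,0,0)\,e^{g(x,u,p)}$ and $L_u - L_{px} - p\,L_{pu} = -e^{g} f(x,u,p,0,0)$ for all $(x,u,p)$. Let $b^0, b^1 : \mathbb{R} \to \mathbb{R}$ be continuously differentiable and assume the boundary compatibility $L_p(\iota, v, b^{\iota}(v)) = 0$ for all $v \in \mathbb{R}$ and $\iota \in \{0,1\}$. Let $T>0$ and let $u : [0,T]\times[0,1] \to \mathbb{R}$ be twice continuously differentiable, satisfy $f(x,u,u_x,u_{xx},u_t) = 0$ on $[0,T]\times[0,1]$ and the Robin boundary conditions $u_x(t,\iota) = b^{\iota}(u(t,\iota))$ for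 $\iota \in \{0,1\}$ and all $t$. Then for every $t \in (0,T)$, $E(t) := \int_0^1 L(x,u,u_x)\,dx$ is differentiable and $E'(t) = -\int_0^1 e^{g(x,u,u_x)}\, F^1(x,u,u_x,u_{xx},u_t)\, u_t\,dx$. -/

import Mathlib

open Real Set

/-- Partial derivative of `u(t,x)` with respect to time `t`. -/
noncomputable def pt (u : ℝ → ℝ → ℝ) (t x : ℝ) : ℝ := deriv (fun s => u s x) t

/-- Partial derivative of `u(t,x)` with respect to space `x`. -/
noncomputable def px (u : ℝ → ℝ → ℝ) (t x : ℝ) : ℝ := deriv (fun y => u t y) x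

/-- Second partial derivative of `u(t,x)` with respect to space `x`. -/
noncomputable def pxx (u : ℝ → ℝ → ℝ) (t x : ℝ) : ℝ := deriv (fun y => px u t y) x

/-- `f_q(x,u,p,0,0)`: partial derivative of `f(x,u,p,q,r)` in its fourth slot,
evaluated at `q = r = 0`. -/
noncomputable def fq0 (f : ℝ → ℝ → ℝ → ℝ → ℝ → ℝ) (x u p : ℝ) : ℝ :=
  deriv (fun q => f x u p q 0) 0

/-- `F¹(x,u,p,q,r) := f(x,u,p,0,0) + f_q(x,u,p,0,0) q - f(x,u,p,q,r)`. -/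
noncomputable def F1 (f : ℝ → ℝ → ℝ → ℝ → ℝ → ℝ) (x u p q r : ℝ) : ℝ :=
  f x u p 0 0 + fq0 f x u p * q - f x u p q r

/-- `L_p(x,u,p)`. -/
noncomputable def Lp (L : ℝ → ℝ → ℝ → ℝ) (x u p : ℝ) : ℝ := deriv (fun p' => L x u p') p

/-- `L_pp(x,u,p)`. -/
noncomputable def Lpp (L : ℝ → ℝ → ℝ → ℝ) (x u p : ℝ) : ℝ := deriv (fun p' => Lp L x u p') p

/-- `L_u(x,u,p)`. -/
noncomputable def Lu (L : ℝ → ℝ → ℝ → ℝ) (x u p : ℝ) : ℝ := deriv (fun u' => L x u' p) u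

/-- `L_px(x,u,p)`. -/
noncomputable def Lpx (L : ℝ → ℝ → ℝ → ℝ) (x u p : ℝ) : ℝ := deriv (fun x' => Lp L x' u p) x

/-- `L_pu(x,u,p)`. -/
noncomputable def Lpu (L : ℝ → ℝ → ℝ → ℝ) (x u p : ℝ) : ℝ := deriv (fun u' => Lp L x u' p) u

section PartialDerivatives

variable {H : ℝ → ℝ → ℝ} {A : ℝ → ℝ → ℝ → ℝ}

theorem hasDerivAt_partial_fst (hH : Differentiable ℝ fun q : ℝ × ℝ => H q.1 q.2) (t x : ℝ) :
    HasDerivAt (fun s => H s x) (fderiv ℝ (fun q : ℝ × ℝ => H q.1 q.2) (t, x) (1, 0)) t :=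
  (hH (t, x)).hasFDerivAt.comp_hasDerivAt (f := fun s => (s, x)) t
    ((hasDerivAt_id' t).prodMk (hasDerivAt_const t x))

theorem hasDerivAt_partial_snd (hH : Differentiable ℝ fun q : ℝ × ℝ => H q.1 q.2) (t x : ℝ) :
    HasDerivAt (fun y => H t y) (fderiv ℝ (fun q : ℝ × ℝ => H q.1 q.2) (t, x) (0, 1)) x :=
  (hH (t, x)).hasFDerivAt.comp_hasDerivAt x ((hasDerivAt_const x t).prodMk (hasDerivAt_id' x))

theorem pt_eq_fderiv (hH : Differentiable ℝ fun q : ℝ × ℝ => H q.1 q.2) (t x : ℝ) :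
    pt H t x = fderiv ℝ (fun q : ℝ × ℝ => H q.1 q.2) (t, x) (1, 0) :=
  (hasDerivAt_partial_fst hH t x).deriv

theorem px_eq_fderiv (hH : Differentiable ℝ fun q : ℝ × ℝ => H q.1 q.2) (t x : ℝ) :
    px H t x = fderiv ℝ (fun q : ℝ × ℝ => H q.1 q.2) (t, x) (0, 1) :=
  (hasDerivAt_partial_snd hH t x).deriv

theorem hasDerivAt_pt (hH : Differentiable ℝ fun q : ℝ × ℝ => H q.1 q.2) (t x : ℝ) :
    HasDerivAt (fun s => H s x) (pt H t x) t :=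
  (hasDerivAt_partial_fst hH t x).differentiableAt.hasDerivAt

theorem hasDerivAt_px (hH : Differentiable ℝ fun q : ℝ × ℝ => H q.1 q.2) (t x : ℝ) :
    HasDerivAt (fun y => H t y) (px H t x) x :=
  (hasDerivAt_partial_snd hH t x).differentiableAt.hasDerivAt

theorem contDiff_pt {m n : WithTop ℕ∞} (hH : ContDiff ℝ n fun q : ℝ × ℝ => H q.1 q.2)
    (hmn : m + 1 ≤ n) : ContDiff ℝ m fun q : ℝ × ℝ => pt H q.1 q.2 := by
  have hd : Differentiable ℝ fun q : ℝ × ℝ => H q.1 q.2 :=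
    (hH.of_le (le_add_self.trans hmn)).differentiable one_ne_zero
  simp only [pt_eq_fderiv hd]
  exact (hH.fderiv_right hmn).clm_apply contDiff_const

theorem contDiff_px {m n : WithTop ℕ∞} (hH : ContDiff ℝ n fun q : ℝ × ℝ => H q.1 q.2)
    (hmn : m + 1 ≤ n) : ContDiff ℝ m fun q : ℝ × ℝ => px H q.1 q.2 := by
  have hd : Differentiable ℝ fun q : ℝ × ℝ => H q.1 q.2 :=
    (hH.of_le (le_add_self.trans hmn)).differentiable one_ne_zero
  simp only [px_eq_fderiv hd]
  exact (hH.fderiv_right hmn).clm_apply contDiff_const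

/-- Mixed second partial derivatives of a `C²` function commute. -/
theorem pt_px_eq_px_pt (hH : ContDiff ℝ 2 fun q : ℝ × ℝ => H q.1 q.2) (t x : ℝ) :
    pt (px H) t x = px (pt H) t x := by
  have hd : Differentiable ℝ fun q : ℝ × ℝ => H q.1 q.2 := hH.differentiable two_ne_zero
  have hd' : Differentiable ℝ (fderiv ℝ fun q : ℝ × ℝ => H q.1 q.2) :=
    (hH.fderiv_right (m := 1) (by norm_num)).differentiable one_ne_zero
  have hsymm : IsSymmSndFDerivAt ℝ (fun q : ℝ × ℝ => H q.1 q.2) (t, x) :=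
    hH.contDiffAt.isSymmSndFDerivAt (by simp)
  have key (v w : ℝ × ℝ) :
      fderiv ℝ (fun q : ℝ × ℝ => fderiv ℝ (fun q : ℝ × ℝ => H q.1 q.2) q v) (t, x) w =
        fderiv ℝ (fderiv ℝ fun q : ℝ × ℝ => H q.1 q.2) (t, x) w v := by
    rw [fderiv_clm_apply (hd' _) (differentiableAt_const v)]
    simp
  rw [pt_eq_fderiv ((contDiff_px hH (m := 1) (by norm_num)).differentiable one_ne_zero),
    px_eq_fderiv ((contDiff_pt hH (m := 1) (by norm_num)).differentiable one_ne_zero)]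
  simp only [px_eq_fderiv hd, pt_eq_fderiv hd, Prod.mk.eta, key]
  exact hsymm.eq _ _

theorem Lp_eq_fderiv (hA : Differentiable ℝ fun v : ℝ × ℝ × ℝ => A v.1 v.2.1 v.2.2) (x u p : ℝ) :
    Lp A x u p = fderiv ℝ (fun v : ℝ × ℝ × ℝ => A v.1 v.2.1 v.2.2) (x, u, p) (0, 0, 1) :=
  ((hA (x, u, p)).hasFDerivAt.comp_hasDerivAt (f := fun p' => (x, u, p')) p
    ((hasDerivAt_const p x).prodMk ((hasDerivAt_const p u).prodMk (hasDerivAt_id' p)))).deriv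

theorem Lu_eq_fderiv (hA : Differentiable ℝ fun v : ℝ × ℝ × ℝ => A v.1 v.2.1 v.2.2) (x u p : ℝ) :
    Lu A x u p = fderiv ℝ (fun v : ℝ × ℝ × ℝ => A v.1 v.2.1 v.2.2) (x, u, p) (0, 1, 0) :=
  ((hA (x, u, p)).hasFDerivAt.comp_hasDerivAt (f := fun u' => (x, u', p)) u
    ((hasDerivAt_const u x).prodMk ((hasDerivAt_id' u).prodMk (hasDerivAt_const u p)))).deriv

theorem deriv_fst_eq_fderiv (hA : Differentiable ℝ fun v : ℝ × ℝ × ℝ => A v.1 v.2.1 v.2.2)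
    (x u p : ℝ) :
    deriv (fun y => A y u p) x =
      fderiv ℝ (fun v : ℝ × ℝ × ℝ => A v.1 v.2.1 v.2.2) (x, u, p) (1, 0, 0) :=
  ((hA (x, u, p)).hasFDerivAt.comp_hasDerivAt (f := fun x' => (x', u, p)) x
    ((hasDerivAt_id' x).prodMk ((hasDerivAt_const x u).prodMk (hasDerivAt_const x p)))).deriv

theorem contDiff_Lp {m n : WithTop ℕ∞}
    (hA : ContDiff ℝ n fun v : ℝ × ℝ × ℝ => A v.1 v.2.1 v.2.2) (hmn : m + 1 ≤ n) :
    ContDiff ℝ m fun v : ℝ × ℝ × ℝ => Lp A v.1 v.2.1 v.2.2 := by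
  have hd : Differentiable ℝ fun v : ℝ × ℝ × ℝ => A v.1 v.2.1 v.2.2 :=
    (hA.of_le (le_add_self.trans hmn)).differentiable one_ne_zero
  simp only [Lp_eq_fderiv hd]
  exact (hA.fderiv_right hmn).clm_apply contDiff_const

/-- Chain rule for a function of three real variables along a curve. -/
theorem hasDerivAt_comp_three (hA : Differentiable ℝ fun v : ℝ × ℝ × ℝ => A v.1 v.2.1 v.2.2)
    {X U P : ℝ → ℝ} {X' U' P' s : ℝ} (hX : HasDerivAt X X' s) (hU : HasDerivAt U U' s)
    (hP : HasDerivAt P P' s) :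
    HasDerivAt (fun s => A (X s) (U s) (P s))
      (deriv (fun y => A y (U s) (P s)) (X s) * X' + Lu A (X s) (U s) (P s) * U' +
        Lp A (X s) (U s) (P s) * P') s := by
  have h := (hA (X s, U s, P s)).hasFDerivAt.comp_hasDerivAt
    (f := fun s => (X s, U s, P s)) s (hX.prodMk (hU.prodMk hP))
  have hv : (X', U', P') = X' • ((1 : ℝ), (0 : ℝ), (0 : ℝ)) + U' • ((0 : ℝ), (1 : ℝ), (0 : ℝ)) +
      P' • ((0 : ℝ), (0 : ℝ), (1 : ℝ)) := by
    simp
  rw [hv, map_add, map_add, map_smul, map_smul, map_smul, ← deriv_fst_eq_fderiv hA,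
    ← Lu_eq_fderiv hA, ← Lp_eq_fderiv hA] at h
  simpa only [smul_eq_mul, mul_comm, Function.comp_def] using h

/-- Differentiation under the integral sign for a `C¹` integrand. -/
theorem hasDerivAt_intervalIntegral_of_contDiff
    (hH : ContDiff ℝ 1 fun q : ℝ × ℝ => H q.1 q.2) (a b t : ℝ) :
    HasDerivAt (fun s => ∫ x in a..b, H s x) (∫ x in a..b, pt H t x) t := by
  have hc : Continuous fun q : ℝ × ℝ => H q.1 q.2 := hH.continuous
  have hc' : Continuous fun q : ℝ × ℝ => pt H q.1 q.2 :=
    (contDiff_pt hH (m := 0) (by norm_num)).continuous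
  have hs (s : ℝ) : Continuous fun x : ℝ => (s, x) := by fun_prop
  obtain ⟨C, hC⟩ := ((isCompact_Icc (a := t - 1) (b := t + 1)).prod
    (isCompact_uIcc (a := a) (b := b))).exists_bound_of_continuousOn hc'.continuousOn
  refine (intervalIntegral.hasDerivAt_integral_of_dominated_loc_of_deriv_le
    (bound := fun _ => C) (F' := pt H) (Icc_mem_nhds (sub_one_lt t) (lt_add_one t))
    (.of_forall fun s => (hc.comp (hs s)).aestronglyMeasurable)
    ((hc.comp (hs t)).intervalIntegrable a b) (hc'.comp (hs t)).aestronglyMeasurable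
    (.of_forall fun x hx s hst => hC (s, x) ⟨hst, uIoc_subset_uIcc hx⟩)
    intervalIntegrable_const
    (.of_forall fun x _ s _ => hasDerivAt_pt (hH.differentiable one_ne_zero) s x)).2

end PartialDerivatives

/-- Energy identity with nonlinear Robin boundary conditions. -/
theorem energy_identity_fully_nonlinear_robin
    (f : ℝ → ℝ → ℝ → ℝ → ℝ → ℝ)
    (hf : ContDiff ℝ 1 (fun v : ℝ × ℝ × ℝ × ℝ × ℝ => f v.1 v.2.1 v.2.2.1 v.2.2.2.1 v.2.2.2.2))
    (g : ℝ → ℝ → ℝ → ℝ)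
    (hg : Continuous (fun v : ℝ × ℝ × ℝ => g v.1 v.2.1 v.2.2))
    (L : ℝ → ℝ → ℝ → ℝ)
    (hL : ContDiff ℝ 2 (fun v : ℝ × ℝ × ℝ => L v.1 v.2.1 v.2.2))
    (hLpp : ∀ x ∈ Icc (0:ℝ) 1, ∀ u p : ℝ,
      Lpp L x u p = fq0 f x u p * Real.exp (g x u p))
    (hLid : ∀ x ∈ Icc (0:ℝ) 1, ∀ u p : ℝ,
      Lu L x u p - Lpx L x u p - p * Lpu L x u p = -Real.exp (g x u p) * f x u p 0 0)
    (b0 b1 : ℝ → ℝ)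
    (hb0 : ContDiff ℝ 1 b0) (hb1 : ContDiff ℝ 1 b1)
    (hcompat0 : ∀ v : ℝ, Lp L 0 v (b0 v) = 0)
    (hcompat1 : ∀ v : ℝ, Lp L 1 v (b1 v) = 0)
    (T : ℝ) (hT : 0 < T)
    (u : ℝ → ℝ → ℝ)
    (hu : ContDiff ℝ 2 (fun q : ℝ × ℝ => u q.1 q.2))
    (hPDE : ∀ t ∈ Icc (0:ℝ) T, ∀ x ∈ Icc (0:ℝ) 1,
      f x (u t x) (px u t x) (pxx u t x) (pt u t x) = 0)
    (hRobin : ∀ t ∈ Icc (0:ℝ) T, px u t 0 = b0 (u t 0) ∧ px u t 1 = b1 (u t 1)) :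
    ∀ t ∈ Ioo (0:ℝ) T,
      HasDerivAt (fun s => ∫ x in (0:ℝ)..1, L x (u s x) (px u s x))
        (-∫ x in (0:ℝ)..1,
          Real.exp (g x (u t x) (px u t x)) *
            F1 f x (u t x) (px u t x) (pxx u t x) (pt u t x) * pt u t x) t := by
  intro t ht
  have ht' : t ∈ Icc (0 : ℝ) T := Ioo_subset_Icc_self ht
  have hu' : Differentiable ℝ fun q : ℝ × ℝ => u q.1 q.2 := hu.differentiable two_ne_zero
  have hu1 : ContDiff ℝ 1 fun q : ℝ × ℝ => u q.1 q.2 := hu.of_le (by norm_num)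
  have hux : ContDiff ℝ 1 fun q : ℝ × ℝ => px u q.1 q.2 := contDiff_px hu (by norm_num)
  have hut : ContDiff ℝ 1 fun q : ℝ × ℝ => pt u q.1 q.2 := contDiff_pt hu (by norm_num)
  have hLp : ContDiff ℝ 1 fun v : ℝ × ℝ × ℝ => Lp L v.1 v.2.1 v.2.2 := contDiff_Lp hL (by norm_num)
  have hG : ContDiff ℝ 1 fun q : ℝ × ℝ => L q.2 (u q.1 q.2) (px u q.1 q.2) :=
    (hL.of_le (by norm_num)).comp (contDiff_snd.prodMk (hu1.prodMk hux))
  have hslice : ContDiff ℝ 1 fun x : ℝ => (t, x) := contDiff_const.prodMk contDiff_id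
  have hflux : ContDiff ℝ 1 fun x => Lp L x (u t x) (px u t x) * pt u t x :=
    (hLp.comp (contDiff_id.prodMk ((hu1.comp hslice).prodMk (hux.comp hslice)))).mul
      (hut.comp hslice)
  have hE := hasDerivAt_intervalIntegral_of_contDiff
    (H := fun s x => L x (u s x) (px u s x)) hG 0 1 t
  have hpt (x : ℝ) : pt (fun s x => L x (u s x) (px u s x)) t x =
      Lu L x (u t x) (px u t x) * pt u t x +
        Lp L x (u t x) (px u t x) * px (pt u) t x := by
    have h := hasDerivAt_comp_three (hL.differentiable two_ne_zero) (hasDerivAt_const t x)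
      (hasDerivAt_pt hu' t x) (hasDerivAt_pt (hux.differentiable one_ne_zero) t x)
    rw [pt_px_eq_px_pt hu, mul_zero, zero_add] at h
    exact h.deriv
  have hflux' (x : ℝ) : deriv (fun x => Lp L x (u t x) (px u t x) * pt u t x) x =
      (Lpx L x (u t x) (px u t x) + Lpu L x (u t x) (px u t x) * px u t x +
        Lpp L x (u t x) (px u t x) * pxx u t x) * pt u t x +
        Lp L x (u t x) (px u t x) * px (pt u) t x := by
    have h := (hasDerivAt_comp_three (hLp.differentiable one_ne_zero) (hasDerivAt_id' x)
      (hasDerivAt_px hu' t x) (hasDerivAt_px (hux.differentiable one_ne_zero) t x)).mul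
      (hasDerivAt_px (hut.differentiable one_ne_zero) t x)
    rw [mul_one] at h
    exact h.deriv
  have hident : ∀ x ∈ uIcc (0 : ℝ) 1,
      pt (fun s x => L x (u s x) (px u s x)) t x -
        deriv (fun x => Lp L x (u t x) (px u t x) * pt u t x) x =
      -(Real.exp (g x (u t x) (px u t x)) *
        F1 f x (u t x) (px u t x) (pxx u t x) (pt u t x) * pt u t x) := by
    intro x hx
    rw [uIcc_of_le zero_le_one] at hx
    rw [hpt, hflux', F1, hPDE t ht' x hx, hLpp x hx]
    linear_combination pt u t x * hLid x hx (u t x) (px u t x)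
  have hbdry : ∫ x in (0 : ℝ)..1, deriv (fun x => Lp L x (u t x) (px u t x) * pt u t x) x = 0 := by
    rw [intervalIntegral.integral_deriv_eq_sub
      (fun x _ => (hflux.differentiable one_ne_zero) x)
      ((hflux.continuous_deriv le_rfl).intervalIntegrable 0 1),
      (hRobin t ht').1, (hRobin t ht').2, hcompat0, hcompat1]
    ring
  have hptc : Continuous fun x => pt (fun s x => L x (u s x) (px u s x)) t x :=
    (contDiff_pt (H := fun s x => L x (u s x) (px u s x)) (m := 0) hG (by norm_num)).continuous.comp
      hslice.continuous
  rw [← intervalIntegral.integral_neg, ← intervalIntegral.integral_congr hident,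
    intervalIntegral.integral_sub (hptc.intervalIntegrable 0 1)
      ((hflux.continuous_deriv le_rfl).intervalIntegrable 0 1), hbdry, sub_zero]
  exact hE
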